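/- arXiv:1803.03995 — 4 statements merged into one kernel-verified Lean document; each statement's English description precedes it below -/
import Mathlib

section
/- Let N ≥ 1 and 1 ≤ k ≤ N, and let ν_n^{(k)} be the sinusoidal tapers. For every x ∈ ℝ^N and every f ∈ ℝ, |∑_{n=1}^N ν_n^{(k)} x_n e^{−2πinf}|² = |ζ(f + kΔ) − ζ(f − kΔ)|² / (2(N+1)), where ζ(f) = ∑_{n=1}^N x_n e^{−2πinf} is the discrete Fourier transform of x and Δ = 1/(2N+2). -/
open Complex Finset Real

/-- The difference of two exponentials with symmetrically shifted arguments is a sine times the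
unshifted exponential. -/
lemma Complex.exp_neg_add_sub_exp_neg_sub (a θ : ℂ) :
    Complex.exp (-(a + θ * I)) - Complex.exp (-(a - θ * I)) =
      -2 * I * (Complex.sin θ * Complex.exp (-a)) := by
  have h₁ : -(a + θ * I) = -a + -θ * I := by ring
  have h₂ : -(a - θ * I) = -a + θ * I := by ring
  rw [h₁, h₂, Complex.exp_add, Complex.exp_add, Complex.sin]
  linear_combination (Complex.exp (-a) * (Complex.exp (-θ * I) - Complex.exp (θ * I))) * I_sq

/-- For `N ≥ 1`, `1 ≤ k ≤ N`, the sinusoidal tapers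
`ν_n^{(k)} = √(2/(N+1)) sin(πkn/(N+1))` satisfy, for every `x ∈ ℝ^N` and `f ∈ ℝ`,
`|∑_{n=1}^N ν_n^{(k)} x_n e^{−2πinf}|² = |ζ(f + kΔ) − ζ(f − kΔ)|² / (2(N+1))`,
where `ζ(f) = ∑_{n=1}^N x_n e^{−2πinf}` and `Δ = 1/(2N+2)`. -/
theorem sinusoidal_taper_dft_representation
    (N : ℕ) (hN : 1 ≤ N) (k : ℕ) (hk1 : 1 ≤ k) (hkN : k ≤ N)
    (x : ℕ → ℝ) (f : ℝ)
    (ν : ℕ → ℕ → ℝ)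
    (hν : ∀ k' n, ν k' n = Real.sqrt (2 / (N + 1)) * Real.sin (Real.pi * k' * n / (N + 1)))
    (ζ : ℝ → ℂ)
    (hζ : ∀ g : ℝ, ζ g = ∑ n ∈ Finset.Icc 1 N, (x n : ℂ) *
      Complex.exp (-(2 * Real.pi * Complex.I * n * g)))
    (Δ : ℝ) (hΔ : Δ = 1 / (2 * N + 2)) :
    Complex.normSq (∑ n ∈ Finset.Icc 1 N, (ν k n : ℂ) * (x n : ℂ) *
        Complex.exp (-(2 * Real.pi * Complex.I * n * f)))
      = Complex.normSq (ζ (f + k * Δ) - ζ (f - k * Δ)) / (2 * (N + 1)) := by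
  set S : ℂ := ∑ n ∈ Finset.Icc 1 N,
    ((Real.sin (Real.pi * k * n / (N + 1)) : ℝ) : ℂ) * (x n : ℂ) *
      Complex.exp (-(2 * Real.pi * Complex.I * n * f)) with hS
  have taper : ∑ n ∈ Finset.Icc 1 N, (ν k n : ℂ) * (x n : ℂ) *
      Complex.exp (-(2 * Real.pi * Complex.I * n * f)) =
        ((Real.sqrt (2 / (N + 1)) : ℝ) : ℂ) * S := by
    rw [hS, Finset.mul_sum]
    refine Finset.sum_congr rfl fun n _ => ?_
    rw [hν, Complex.ofReal_mul]
    ring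
  have difference : ζ (f + k * Δ) - ζ (f - k * Δ) = -2 * I * S := by
    rw [hζ, hζ, hS, ← Finset.sum_sub_distrib, Finset.mul_sum]
    refine Finset.sum_congr rfl fun n _ => ?_
    have hN' : (N : ℂ) + 1 ≠ 0 := by exact_mod_cast N.succ_ne_zero
    have hphase : 2 * (Real.pi : ℂ) * n * (k * Δ) = Real.pi * k * n / (N + 1) := by
      have h2 : (2 * N + 2 : ℂ) = 2 * (N + 1) := by ring
      rw [hΔ]
      push_cast
      rw [h2]
      field_simp
    have key := Complex.exp_neg_add_sub_exp_neg_sub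
      (2 * Real.pi * I * n * f) (Real.pi * k * n / (N + 1))
    rw [← hphase] at key
    have hplus : 2 * (Real.pi : ℂ) * I * n * ((f + k * Δ : ℝ) : ℂ) =
        2 * Real.pi * I * n * f + 2 * Real.pi * n * (k * Δ) * I := by
      push_cast
      ring
    have hminus : 2 * (Real.pi : ℂ) * I * n * ((f - k * Δ : ℝ) : ℂ) =
        2 * Real.pi * I * n * f - 2 * Real.pi * n * (k * Δ) * I := by
      push_cast
      ring
    rw [hplus, hminus, ← mul_sub, key, hphase]
    push_cast
    ring
  rw [taper, difference, Complex.normSq_mul, Complex.normSq_mul, Complex.normSq_mul,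
    Complex.normSq_ofReal, Real.mul_self_sqrt (by positivity), Complex.normSq_neg,
    Complex.normSq_I, Complex.normSq_ofNat]
  field_simp
end

section
/- Let N, K ≥ 1 be integers with 2K ≤ N. Then (1/K²) ∑_{k=1}^K ∑_{k'=1}^K ∑_{n=1}^N |ν_n^{(k)}|² |ν_n^{(k')}|² = (4/(K²(N+1)²)) ∑_{k=1}^K ∑_{k'=1}^K ∑_{n=1}^N sin²(πkn/(N+1)) sin²(πk'n/(N+1)) = (2K+1)/(2K(N+1)). -/
open Finset Real

lemma two_mul_sin_half_mul_sum_cos (x : ℝ) (M : ℕ) :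
    2 * Real.sin (x / 2) * ∑ n ∈ Finset.range M, Real.cos (n * x)
      = Real.sin ((M - 1 / 2) * x) + Real.sin (x / 2) := by
  induction M with
  | zero => simp [show (-2⁻¹ : ℝ) * x = -(x / 2) by ring]
  | succ M ih =>
    rw [Finset.sum_range_succ, mul_add, ih]
    have h₁ : ((M : ℝ) - 1 / 2) * x = M * x - x / 2 := by ring
    have h₂ : (((M + 1 : ℕ) : ℝ) - 1 / 2) * x = M * x + x / 2 := by push_cast; ring
    rw [h₁, h₂, Real.sin_add, Real.sin_sub]
    ring

lemma sum_cos_two_pi_mul_div_eq_zero {M : ℕ} (hM : M ≠ 0) {z : ℤ} (hz : ¬ (M : ℤ) ∣ z) :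
    ∑ n ∈ Finset.range M, Real.cos (n * (2 * Real.pi * z / M)) = 0 := by
  have hM' : (M : ℝ) ≠ 0 := Nat.cast_ne_zero.mpr hM
  have h := two_mul_sin_half_mul_sum_cos (2 * Real.pi * z / M) M
  have harg : ((M : ℝ) - 1 / 2) * (2 * Real.pi * z / M)
      = z * (2 * Real.pi) - 2 * Real.pi * z / M / 2 := by
    field_simp
  rw [harg, Real.sin_int_mul_two_pi_sub, neg_add_cancel] at h
  have hsin : Real.sin (2 * Real.pi * z / M / 2) ≠ 0 := by
    rw [Ne, Real.sin_eq_zero_iff]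
    rintro ⟨m, hm⟩
    refine hz ⟨m, ?_⟩
    have : (z : ℝ) = M * m := by
      field_simp at hm
      linarith
    exact_mod_cast this
  simpa [hsin] using h

lemma sum_sin_sq_mul_sin_sq {N k l : ℕ} (hk : 1 ≤ k) (hl : 1 ≤ l) (hkl : k + l ≤ N) :
    ∑ n ∈ Finset.Icc 1 N,
        Real.sin (Real.pi * k * n / (N + 1)) ^ 2 * Real.sin (Real.pi * l * n / (N + 1)) ^ 2
      = ((N : ℝ) + 1) / 4 + if k = l then ((N : ℝ) + 1) / 8 else 0 := by
  let C : ℤ → ℝ := fun z ↦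
    ∑ n ∈ Finset.range (N + 1), Real.cos (n * (2 * Real.pi * z / (N + 1 : ℕ)))
  have hC : ∀ z : ℤ, z ≠ 0 → |z| ≤ N → C z = 0 := fun z hz hzN ↦
    sum_cos_two_pi_mul_div_eq_zero N.succ_ne_zero fun hdvd ↦
      hz (Int.eq_zero_of_abs_lt_dvd hdvd (by push_cast; omega))
  have hsum : ∑ n ∈ Finset.Icc 1 N,
        Real.sin (Real.pi * k * n / (N + 1)) ^ 2 * Real.sin (Real.pi * l * n / (N + 1)) ^ 2
      = ((N : ℝ) + 1) / 4 - C k / 4 - C l / 4 + C (k + l) / 8 + C (k - l) / 8 := by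
    have hrange : ∑ n ∈ Finset.range (N + 1),
          Real.sin (Real.pi * k * n / (N + 1)) ^ 2 * Real.sin (Real.pi * l * n / (N + 1)) ^ 2
        = ∑ n ∈ Finset.Icc 1 N,
          Real.sin (Real.pi * k * n / (N + 1)) ^ 2
            * Real.sin (Real.pi * l * n / (N + 1)) ^ 2 := by
      rw [Finset.range_eq_Ico, Finset.sum_eq_sum_Ico_succ_bot N.succ_pos]
      simp [Finset.Ico_add_one_right_eq_Icc]
    have hconst : ((N : ℝ) + 1) / 4 = ∑ _n ∈ Finset.range (N + 1), (1 / 4 : ℝ) := by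
      simp [div_eq_mul_inv]
    rw [← hrange, hconst]
    simp only [C, Finset.sum_div, ← Finset.sum_sub_distrib, ← Finset.sum_add_distrib]
    refine Finset.sum_congr rfl fun n _ ↦ ?_
    set a : ℝ := Real.pi * k * n / (N + 1) with ha
    set b : ℝ := Real.pi * l * n / (N + 1) with hb
    have h₁ : (n : ℝ) * (2 * Real.pi * ((k : ℤ) : ℝ) / (N + 1 : ℕ)) = 2 * a := by
      rw [ha]; push_cast; ring
    have h₂ : (n : ℝ) * (2 * Real.pi * ((l : ℤ) : ℝ) / (N + 1 : ℕ)) = 2 * b := by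
      rw [hb]; push_cast; ring
    have h₃ : (n : ℝ) * (2 * Real.pi * ((k + l : ℤ) : ℝ) / (N + 1 : ℕ)) = 2 * a + 2 * b := by
      rw [ha, hb]; push_cast; ring
    have h₄ : (n : ℝ) * (2 * Real.pi * ((k - l : ℤ) : ℝ) / (N + 1 : ℕ)) = 2 * a - 2 * b := by
      rw [ha, hb]; push_cast; ring
    rw [h₁, h₂, h₃, h₄, Real.cos_add, Real.cos_sub, Real.sin_sq_eq_half_sub,
      Real.sin_sq_eq_half_sub]
    ring
  rw [hsum, hC k (by omega) (by rw [abs_le]; omega), hC l (by omega) (by rw [abs_le]; omega),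
    hC (k + l) (by omega) (by rw [abs_le]; omega)]
  split_ifs with h
  · have h0 : C (k - l) = N + 1 := by simp [C, h]
    rw [h0]
    ring
  · rw [hC (k - l) (by omega) (by rw [abs_le]; omega)]
    ring

/-- For integers `N, K ≥ 1` with `2K ≤ N`, with the sinusoidal tapers
`ν_n^{(k)} = √(2/(N+1)) sin(πkn/(N+1))`, one has
`(1/K²) ∑_{k=1}^K ∑_{k'=1}^K ∑_{n=1}^N |ν_n^{(k)}|² |ν_n^{(k')}|²
  = (4/(K²(N+1)²)) ∑_{k=1}^K ∑_{k'=1}^K ∑_{n=1}^N sin²(πkn/(N+1)) sin²(πk'n/(N+1))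
  = (2K+1)/(2K(N+1))`. -/
theorem sinusoidal_taper_variance_sum
    (N K : ℕ) (hN : 1 ≤ N) (hK : 1 ≤ K) (hKN : 2 * K ≤ N)
    (ν : ℕ → ℕ → ℝ)
    (hν : ∀ k n, ν k n = Real.sqrt (2 / (N + 1)) * Real.sin (Real.pi * k * n / (N + 1))) :
    (1 / (K : ℝ) ^ 2) * ∑ k ∈ Finset.Icc 1 K, ∑ k' ∈ Finset.Icc 1 K,
        ∑ n ∈ Finset.Icc 1 N, (ν k n) ^ 2 * (ν k' n) ^ 2
      = (4 / ((K : ℝ) ^ 2 * ((N : ℝ) + 1) ^ 2)) * ∑ k ∈ Finset.Icc 1 K,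
          ∑ k' ∈ Finset.Icc 1 K, ∑ n ∈ Finset.Icc 1 N,
            Real.sin (Real.pi * k * n / (N + 1)) ^ 2 * Real.sin (Real.pi * k' * n / (N + 1)) ^ 2
    ∧ (4 / ((K : ℝ) ^ 2 * ((N : ℝ) + 1) ^ 2)) * ∑ k ∈ Finset.Icc 1 K,
          ∑ k' ∈ Finset.Icc 1 K, ∑ n ∈ Finset.Icc 1 N,
            Real.sin (Real.pi * k * n / (N + 1)) ^ 2 * Real.sin (Real.pi * k' * n / (N + 1)) ^ 2
      = (2 * K + 1) / (2 * K * ((N : ℝ) + 1)) := by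
  have hK0 : (K : ℝ) ≠ 0 := by positivity
  have hN0 : (N : ℝ) + 1 ≠ 0 := by positivity
  constructor
  · have hsq : Real.sqrt (2 / ((N : ℝ) + 1)) ^ 2 = 2 / (N + 1) := Real.sq_sqrt (by positivity)
    simp only [Finset.mul_sum, hν, mul_pow, hsq]
    refine Finset.sum_congr rfl fun k _ ↦ Finset.sum_congr rfl fun l _ ↦
      Finset.sum_congr rfl fun n _ ↦ ?_
    field_simp
    ring
  · have hsum : ∑ k ∈ Finset.Icc 1 K, ∑ k' ∈ Finset.Icc 1 K, ∑ n ∈ Finset.Icc 1 N,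
          Real.sin (Real.pi * k * n / (N + 1)) ^ 2 * Real.sin (Real.pi * k' * n / (N + 1)) ^ 2
        = ∑ k ∈ Finset.Icc 1 K, (K * (((N : ℝ) + 1) / 4) + ((N : ℝ) + 1) / 8) := by
      refine Finset.sum_congr rfl fun k hk ↦ ?_
      have hk' := Finset.mem_Icc.mp hk
      rw [Finset.sum_congr rfl fun l hl ↦ sum_sin_sq_mul_sin_sq hk'.1 (Finset.mem_Icc.mp hl).1
        (by have := (Finset.mem_Icc.mp hl).2; omega), Finset.sum_add_distrib,
        Finset.sum_ite_eq, if_pos hk]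
      simp
    rw [hsum, Finset.sum_const, Nat.card_Icc, Nat.add_sub_cancel, nsmul_eq_mul]
    field_simp
    ring
end

section
/- Let N ≥ 1 and let k be an integer with 1 ≤ k ≤ N and 2k ≠ N+1. Then ∑_{n=1}^N sin⁴(πkn/(N+1)) = 3(N+1)/8; consequently, for the sinusoidal tapers, ∑_{n=1}^N |ν_n^{(k)}|⁴ = 3/(2(N+1)), so (N+1) ∑_{n=1}^N |ν_n^{(k)}|⁴ = 3/2. -/
open Finset Real

/-- Closed form, up to the factor `2 sin x`, of `∑_{n<m} cos(2nx)`. -/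
theorem two_mul_sin_mul_sum_range_cos (x : ℝ) (m : ℕ) :
    2 * sin x * ∑ n ∈ range m, cos (2 * n * x) = sin (2 * m * x - x) + sin x := by
  induction m with
  | zero => simp
  | succ m ih =>
    have h : sin (2 * ((m + 1 : ℕ) : ℝ) * x - x) = sin (2 * m * x + x) := by
      congr 1; push_cast; ring
    rw [sum_range_succ, mul_add, ih, h, sin_add, sin_sub]
    ring

/-- The cosines at the multiples of `2πj/M` sum to zero over a period unless `M ∣ j`. -/
theorem sum_range_cos_two_mul_pi_eq_zero {M j : ℕ} (hM : M ≠ 0) (hj : ¬ M ∣ j) :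
    ∑ n ∈ range M, cos (2 * n * (π * j / M)) = 0 := by
  have hM' : (M : ℝ) ≠ 0 := Nat.cast_ne_zero.mpr hM
  have hsin : sin (π * j / M) ≠ 0 := by
    intro h
    obtain ⟨m, hm⟩ := sin_eq_zero_iff.mp h
    have hmj : (m : ℝ) * M = j := by
      field_simp at hm
      linarith
    exact hj (Int.natCast_dvd_natCast.mp ⟨m, by rw [mul_comm]; exact_mod_cast hmj.symm⟩)
  have hperiod : 2 * (M : ℝ) * (π * j / M) - π * j / M = j * (2 * π) - π * j / M := by
    field_simp
  have h := two_mul_sin_mul_sum_range_cos (π * j / M) M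
  rw [hperiod, sin_nat_mul_two_pi_sub, neg_add_cancel] at h
  exact (mul_eq_zero.mp h).resolve_left (mul_ne_zero two_ne_zero hsin)

theorem sin_pow_four_eq (y : ℝ) : sin y ^ 4 = 3 / 8 - cos (2 * y) / 2 + cos (4 * y) / 8 := by
  rw [show 4 * y = 2 * (2 * y) by ring, cos_two_mul (2 * y), cos_two_mul y]
  linear_combination (sin y ^ 2 + 1 - cos y ^ 2) * sin_sq_add_cos_sq y

theorem sum_range_sin_pow_four {M k : ℕ} (hM : M ≠ 0) (hk : ¬ M ∣ 2 * k) :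
    ∑ n ∈ range M, sin (π * k * n / M) ^ 4 = 3 * (M : ℝ) / 8 := by
  have h₁ := sum_range_cos_two_mul_pi_eq_zero hM fun h => hk (h.mul_left 2)
  have h₂ := sum_range_cos_two_mul_pi_eq_zero hM hk
  have hterm : ∀ n : ℕ, sin (π * k * n / M) ^ 4 = 3 / 8 - cos (2 * n * (π * k / M)) / 2
      + cos (2 * n * (π * (2 * k : ℕ) / M)) / 8 := by
    intro n
    have e₁ : 2 * (π * k * n / M) = 2 * n * (π * k / M) := by ring
    have e₂ : 4 * (π * k * n / M) = 2 * n * (π * (2 * k : ℕ) / M) := by push_cast; ring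
    rw [sin_pow_four_eq, e₁, e₂]
  simp_rw [hterm, sum_add_distrib, sum_sub_distrib, ← sum_div, h₁, h₂]
  simp
  ring

/-- For `N ≥ 1` and `1 ≤ k ≤ N` with `2k ≠ N+1`,
`∑_{n=1}^N sin⁴(πkn/(N+1)) = 3(N+1)/8`; consequently, for the sinusoidal tapers
`ν_n^{(k)} = √(2/(N+1)) sin(πkn/(N+1))`, `∑_{n=1}^N |ν_n^{(k)}|⁴ = 3/(2(N+1))`,
so `(N+1) ∑_{n=1}^N |ν_n^{(k)}|⁴ = 3/2`. -/
theorem sinusoidal_taper_fourth_power_sum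
    (N k : ℕ) (hN : 1 ≤ N) (hk1 : 1 ≤ k) (hkN : k ≤ N) (hk2 : 2 * k ≠ N + 1)
    (ν : ℕ → ℕ → ℝ)
    (hν : ∀ k' n, ν k' n = Real.sqrt (2 / (N + 1)) * Real.sin (Real.pi * k' * n / (N + 1))) :
    (∑ n ∈ Finset.Icc 1 N, Real.sin (Real.pi * k * n / (N + 1)) ^ 4
        = 3 * ((N : ℝ) + 1) / 8)
    ∧ (∑ n ∈ Finset.Icc 1 N, (ν k n) ^ 4 = 3 / (2 * ((N : ℝ) + 1)))
    ∧ ((N : ℝ) + 1) * ∑ n ∈ Finset.Icc 1 N, (ν k n) ^ 4 = 3 / 2 := by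
  have hdvd : ¬ (N + 1) ∣ 2 * k := by
    rintro ⟨c, hc⟩
    have hc2 : c < 2 := by
      by_contra! h
      have := Nat.mul_le_mul_left (N + 1) h
      omega
    interval_cases c <;> omega
  have hsum : ∑ n ∈ Finset.Icc 1 N, sin (π * k * n / (N + 1)) ^ 4 = 3 * ((N : ℝ) + 1) / 8 := by
    have h := sum_range_sin_pow_four N.succ_ne_zero hdvd
    rw [range_eq_Ico, sum_eq_sum_Ico_succ_bot N.succ_pos] at h
    simpa [← Finset.Ico_add_one_right_eq_Icc] using h
  have hN1 : (N : ℝ) + 1 ≠ 0 := by positivity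
  have hν4 : ∑ n ∈ Finset.Icc 1 N, ν k n ^ 4 = 3 / (2 * ((N : ℝ) + 1)) := by
    have hsqrt : √(2 / ((N : ℝ) + 1)) ^ 4 = (2 / (N + 1)) ^ 2 := by
      rw [show 4 = 2 * 2 by rfl, pow_mul, sq_sqrt (by positivity)]
    simp_rw [hν, mul_pow, ← mul_sum, hsum, hsqrt]
    field_simp
    norm_num
  refine ⟨hsum, hν4, ?_⟩
  rw [hν4]
  field_simp
end

section
/- Let N ≥ 1, let x ∈ ℝ^N, let ζ(f) = ∑_{n=1}^N x_n e^{−2πinf}, and let Δ = 1/(2N+2). Then for all weights μ_1,…,μ_K summing over k, the sinusoidal multi-taper estimate satisfies ∑_{k=1}^K μ_k |∑_{n=1}^N ν_n^{(k)} x_n e^{−2πinf}|² = Δ ∑_{k=1}^K μ_k |ζ(f+kΔ) − ζ(f−kΔ)|², where ν_n^{(k)} are the sinusoidal tapers. -/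
open Complex Finset Real

/-- Shifting the frequency `f` of the oscillation `e^{−2πinf}` by `±d` and subtracting
multiplies it by `−2i sin(2πnd)`. -/
lemma exp_freq_shift_sub (n : ℕ) (f d : ℝ) :
    Complex.exp (-(2 * Real.pi * Complex.I * n * ((f + d : ℝ) : ℂ))) -
        Complex.exp (-(2 * Real.pi * Complex.I * n * ((f - d : ℝ) : ℂ))) =
      -2 * Complex.I * (Real.sin (2 * Real.pi * n * d) : ℂ) *
        Complex.exp (-(2 * Real.pi * Complex.I * n * f)) := by
  have h₁ : -(2 * Real.pi * Complex.I * n * ((f + d : ℝ) : ℂ)) =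
      -(2 * Real.pi * n * d : ℂ) * Complex.I + -(2 * Real.pi * Complex.I * n * f) := by
    push_cast; ring
  have h₂ : -(2 * Real.pi * Complex.I * n * ((f - d : ℝ) : ℂ)) =
      (2 * Real.pi * n * d : ℂ) * Complex.I + -(2 * Real.pi * Complex.I * n * f) := by
    push_cast; ring
  rw [h₁, h₂, Complex.exp_add, Complex.exp_add, Complex.ofReal_sin, Complex.sin]
  push_cast
  linear_combination
    (Complex.exp (-(2 * Real.pi * n * d : ℂ) * Complex.I) -
      Complex.exp ((2 * Real.pi * n * d : ℂ) * Complex.I)) *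
        Complex.exp (-(2 * Real.pi * Complex.I * n * f)) * Complex.I_sq

/-- For `N ≥ 1`, `x ∈ ℝ^N`, `ζ(f) = ∑_{n=1}^N x_n e^{−2πinf}`, `Δ = 1/(2N+2)`, and any
weights `μ_1, …, μ_K`, the sinusoidal multi-taper estimate satisfies
`∑_{k=1}^K μ_k |∑_{n=1}^N ν_n^{(k)} x_n e^{−2πinf}|²
  = Δ ∑_{k=1}^K μ_k |ζ(f+kΔ) − ζ(f−kΔ)|²`,
where `ν_n^{(k)} = √(2/(N+1)) sin(πkn/(N+1))` are the sinusoidal tapers. -/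
theorem sinusoidal_multitaper_dft_form
    (N : ℕ) (hN : 1 ≤ N) (K : ℕ) (μ : ℕ → ℝ) (x : ℕ → ℝ) (f : ℝ)
    (ν : ℕ → ℕ → ℝ)
    (hν : ∀ k n, ν k n = Real.sqrt (2 / (N + 1)) * Real.sin (Real.pi * k * n / (N + 1)))
    (ζ : ℝ → ℂ)
    (hζ : ∀ g : ℝ, ζ g = ∑ n ∈ Finset.Icc 1 N, (x n : ℂ) *
      Complex.exp (-(2 * Real.pi * Complex.I * n * g)))
    (Δ : ℝ) (hΔ : Δ = 1 / (2 * N + 2)) :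
    ∑ k ∈ Finset.Icc 1 K, μ k *
        Complex.normSq (∑ n ∈ Finset.Icc 1 N, (ν k n : ℂ) * (x n : ℂ) *
          Complex.exp (-(2 * Real.pi * Complex.I * n * f)))
      = Δ * ∑ k ∈ Finset.Icc 1 K, μ k *
          Complex.normSq (ζ (f + k * Δ) - ζ (f - k * Δ)) := by
  have hN' : (N : ℝ) + 1 ≠ 0 := by positivity
  rw [Finset.mul_sum]
  refine Finset.sum_congr rfl fun k _ => ?_
  set S : ℂ := ∑ n ∈ Finset.Icc 1 N, (Real.sin (Real.pi * k * n / (N + 1)) : ℂ) * (x n : ℂ) *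
    Complex.exp (-(2 * Real.pi * Complex.I * n * f)) with hS
  have h_taper : ∑ n ∈ Finset.Icc 1 N, (ν k n : ℂ) * (x n : ℂ) *
      Complex.exp (-(2 * Real.pi * Complex.I * n * f)) =
        (Real.sqrt (2 / (N + 1)) : ℂ) * S := by
    rw [hS, Finset.mul_sum]
    refine Finset.sum_congr rfl fun n _ => ?_
    rw [hν, Complex.ofReal_mul]
    ring
  have h_diff : ζ (f + k * Δ) - ζ (f - k * Δ) = -2 * Complex.I * S := by
    rw [hζ, hζ, ← Finset.sum_sub_distrib, hS, Finset.mul_sum]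
    refine Finset.sum_congr rfl fun n _ => ?_
    have h_angle : 2 * Real.pi * n * (k * Δ) = Real.pi * k * n / (N + 1) := by
      rw [hΔ]; field_simp
    rw [← mul_sub, exp_freq_shift_sub, h_angle]
    ring
  have h_const : Complex.normSq (-2 * Complex.I) = 4 := by
    norm_num [Complex.normSq_apply]
  rw [h_taper, h_diff, Complex.normSq_mul, Complex.normSq_mul, h_const, Complex.normSq_ofReal,
    Real.mul_self_sqrt (by positivity), hΔ]
  field_simp
  ring
end
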